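/- Let T > 0, γ ∈ [0,1), and let X, K¹, K² : [0,T] → ℝ be bounded functions. Then sup_{t∈[0,T]} |Ψ_t(X − γ S(X+K¹)) − Ψ_t(X − γ S(X+K²))| ≤ γ · sup_{t∈[0,T]} |K¹_t − K²_t|, where X − γ S(X+Kⁱ) denotes the function s ↦ X_s − γ·sup_{0≤u≤s}(X_u + Kⁱ_u). (The map K ↦ Ψ(X − γ S(X+K)) is a γ-contraction in the uniform metric.) -/

import Mathlib

open MeasureTheory Set Filter Function

noncomputable section

/-- Running supremum of a path over `[0, t]`. -/
def runSSup (Z : ℝ → ℝ) (t : ℝ) : ℝ := sSup (Z '' Set.Icc 0 t)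

/-- Running supremum of a path with initial maximum level `xbar`. -/
def runSup (xbar : ℝ) (Z : ℝ → ℝ) (t : ℝ) : ℝ := max xbar (runSSup Z t)

/-- Skorokhod regulator at 0. -/
def Psi (Y : ℝ → ℝ) (t : ℝ) : ℝ := max 0 (-(sInf (Y '' Set.Icc 0 t)))

/-- Reflection of a path at 0 from below. -/
def Phi (Y : ℝ → ℝ) (t : ℝ) : ℝ := Y t + Psi Y t

/-- A path, viewed on `[0,∞)`, is càdlàg: right-continuous at every `t ≥ 0` and
with left limits at every `t > 0`. -/
def Cadlag (Z : ℝ → ℝ) : Prop :=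
  (∀ t : ℝ, 0 ≤ t → ContinuousWithinAt Z (Set.Ici t) t) ∧
  (∀ t : ℝ, 0 < t → ∃ l : ℝ, Filter.Tendsto Z (nhdsWithin t (Set.Iio t)) (nhds l))

/-- A càdlàg path has no positive jumps if `ΔZ_t = Z_t - Z_{t-} ≤ 0` for all `t > 0`. -/
def NoPosJumps (Z : ℝ → ℝ) : Prop :=
  ∀ t : ℝ, 0 < t → Z t ≤ Function.leftLim Z t

/-- Lebesgue–Stieltjes measure of an increasing right-continuous path on `[0,∞)`,
without the atom at `0`. -/
def lsMeasureAux (f : ℝ → ℝ) : Measure ℝ := by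
  classical
  exact if h : Monotone (fun t => f (max t 0)) ∧
      ∀ x : ℝ, ContinuousWithinAt (fun t => f (max t 0)) (Set.Ici x) x then
    StieltjesFunction.measure ⟨fun t => f (max t 0), h.1, h.2⟩
  else 0

/-- Lebesgue–Stieltjes measure of an increasing right-continuous path on `[0,∞)`,
with an atom of mass `f 0` at `0`. -/
def lsMeasure (f : ℝ → ℝ) : Measure ℝ :=
  lsMeasureAux f + (ENNReal.ofReal (f 0)) • Measure.dirac 0

/-- `(V, K)` is a tax-reflection pair for `(X, δ, xbar)`. -/
def IsTaxReflectionPair (δ : ℝ → ℝ) (X : ℝ → ℝ) (xbar : ℝ) (V K : ℝ → ℝ) : Prop :=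
  Cadlag V ∧ Cadlag K ∧
  (∀ t : ℝ, 0 ≤ t → 0 ≤ V t) ∧
  MonotoneOn K (Set.Ici 0) ∧
  (∀ t : ℝ, 0 ≤ t →
    V t = X t + K t -
      ∫ s in Set.Ioc (0:ℝ) t, δ (V s)
        ∂(lsMeasure (runSup xbar (fun s => X s + K s)))) ∧
  lsMeasure K {t : ℝ | 0 ≤ t ∧ 0 < V t} = 0

/-- A solution of the ODE `y' = 1 - δ(y)`, `y(0) = y₀`, on `[0,∞)`. -/
def IsFlow (δ : ℝ → ℝ) (y₀ : ℝ) (y : ℝ → ℝ) : Prop :=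
  ContinuousOn y (Set.Ici 0) ∧
  ∀ t : ℝ, 0 ≤ t → y t = y₀ + ∫ s in (0:ℝ)..t, (1 - δ (y s))

/-- `δ` admits a unique flow: for every `y₀ ≥ 0` the ODE `y' = 1 - δ(y)`, `y(0) = y₀`
has exactly one continuous solution on `[0,∞)`. -/
def AdmitsUniqueFlow (δ : ℝ → ℝ) : Prop :=
  ∀ y₀ : ℝ, 0 ≤ y₀ →
    (∃ y : ℝ → ℝ, IsFlow δ y₀ y) ∧
    ∀ y z : ℝ → ℝ, IsFlow δ y₀ y → IsFlow δ y₀ z → ∀ t : ℝ, 0 ≤ t → y t = z t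

/-- Raising a path by at most `C` raises its running supremum by at most `C`. -/
lemma runSSup_le_add {Z₁ Z₂ : ℝ → ℝ} {t C : ℝ} (ht : 0 ≤ t)
    (hZ : BddAbove (Z₂ '' Set.Icc 0 t)) (h : ∀ s ∈ Set.Icc 0 t, Z₁ s ≤ Z₂ s + C) :
    runSSup Z₁ t ≤ runSSup Z₂ t + C := by
  refine csSup_le ((Set.nonempty_Icc.mpr ht).image Z₁) ?_
  rintro _ ⟨s, hs, rfl⟩
  exact (h s hs).trans (add_le_add_left (le_csSup hZ (Set.mem_image_of_mem Z₂ hs)) C)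

/-- Lowering a path by at most `C` raises its Skorokhod regulator by at most `C`. -/
lemma Psi_le_add {Y₁ Y₂ : ℝ → ℝ} {t C : ℝ} (ht : 0 ≤ t) (hC : 0 ≤ C)
    (hY : BddBelow (Y₂ '' Set.Icc 0 t)) (h : ∀ s ∈ Set.Icc 0 t, Y₂ s ≤ Y₁ s + C) :
    Psi Y₁ t ≤ Psi Y₂ t + C := by
  have hInf : sInf (Y₂ '' Set.Icc 0 t) - C ≤ sInf (Y₁ '' Set.Icc 0 t) := by
    refine le_csInf ((Set.nonempty_Icc.mpr ht).image Y₁) ?_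
    rintro _ ⟨s, hs, rfl⟩
    linarith [h s hs, csInf_le hY (Set.mem_image_of_mem Y₂ hs)]
  have h₀ := le_max_left 0 (-sInf (Y₂ '' Set.Icc 0 t))
  have h₁ := le_max_right 0 (-sInf (Y₂ '' Set.Icc 0 t))
  exact max_le (add_nonneg h₀ hC) (by unfold Psi; linarith)

/-- One-sided Lipschitz bound for `K ↦ Ψ(X - γ S(X+K))`. -/
lemma Psi_sub_mul_runSSup_le_add {X K₁ K₂ : ℝ → ℝ} {t γ C M N : ℝ} (ht : 0 ≤ t)
    (hγ : 0 ≤ γ) (hC : 0 ≤ C) (hX : ∀ s ∈ Set.Icc 0 t, |X s| ≤ M)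
    (hK₂ : ∀ s ∈ Set.Icc 0 t, |K₂ s| ≤ N)
    (h : ∀ s ∈ Set.Icc 0 t, |K₁ s - K₂ s| ≤ C) :
    Psi (fun s => X s - γ * runSSup (fun u => X u + K₁ u) s) t ≤
      Psi (fun s => X s - γ * runSSup (fun u => X u + K₂ u) s) t + γ * C := by
  have hsub : ∀ {s}, s ∈ Set.Icc 0 t → ∀ u ∈ Set.Icc 0 s, u ∈ Set.Icc 0 t :=
    fun hs _ hu => ⟨hu.1, hu.2.trans hs.2⟩
  refine Psi_le_add ht (mul_nonneg hγ hC) ⟨-M - γ * (M + N), ?_⟩ fun s hs => ?_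
  · rintro _ ⟨s, hs, rfl⟩
    have hS : runSSup (fun u => X u + K₂ u) s ≤ M + N := by
      refine csSup_le ((Set.nonempty_Icc.mpr hs.1).image _) ?_
      rintro _ ⟨u, hu, rfl⟩
      exact add_le_add (le_of_abs_le (hX u (hsub hs u hu))) (le_of_abs_le (hK₂ u (hsub hs u hu)))
    have := mul_le_mul_of_nonneg_left hS hγ
    have := neg_le_of_abs_le (hX s hs)
    dsimp only
    linarith
  · have hS : runSSup (fun u => X u + K₁ u) s ≤ runSSup (fun u => X u + K₂ u) s + C := by
      refine runSSup_le_add hs.1 ⟨M + N, ?_⟩ fun u hu => ?_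
      · rintro _ ⟨u, hu, rfl⟩
        exact add_le_add (le_of_abs_le (hX u (hsub hs u hu))) (le_of_abs_le (hK₂ u (hsub hs u hu)))
      · linarith [le_of_abs_le (h u (hsub hs u hu))]
    linarith [mul_le_mul_of_nonneg_left hS hγ]

/-- **The map `K ↦ Ψ(X − γ S(X+K))` is a `γ`-contraction in the uniform metric.** -/
theorem skorokhod_tax_map_contraction
    (T γ : ℝ) (hT : 0 < T) (hγ : γ ∈ Set.Ico (0:ℝ) 1)
    (X K1 K2 : ℝ → ℝ)
    (hXbdd : ∃ M : ℝ, ∀ t ∈ Set.Icc (0:ℝ) T, |X t| ≤ M)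
    (hK1bdd : ∃ M : ℝ, ∀ t ∈ Set.Icc (0:ℝ) T, |K1 t| ≤ M)
    (hK2bdd : ∃ M : ℝ, ∀ t ∈ Set.Icc (0:ℝ) T, |K2 t| ≤ M) :
    sSup ((fun t => |Psi (fun s => X s - γ * runSSup (fun u => X u + K1 u) s) t -
        Psi (fun s => X s - γ * runSSup (fun u => X u + K2 u) s) t|) '' Set.Icc 0 T)
      ≤ γ * sSup ((fun t => |K1 t - K2 t|) '' Set.Icc 0 T) := by
  obtain ⟨M, hX⟩ := hXbdd
  obtain ⟨N₁, hK₁⟩ := hK1bdd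
  obtain ⟨N₂, hK₂⟩ := hK2bdd
  have hbdd : BddAbove ((fun t => |K1 t - K2 t|) '' Set.Icc 0 T) := by
    refine ⟨N₁ + N₂, ?_⟩
    rintro _ ⟨t, ht, rfl⟩
    exact (abs_sub _ _).trans (add_le_add (hK₁ t ht) (hK₂ t ht))
  set C := sSup ((fun t => |K1 t - K2 t|) '' Set.Icc 0 T)
  have hC : ∀ s ∈ Set.Icc 0 T, |K1 s - K2 s| ≤ C :=
    fun s hs => le_csSup hbdd (Set.mem_image_of_mem (fun t => |K1 t - K2 t|) hs)
  have hC₀ : 0 ≤ C := (abs_nonneg _).trans (hC 0 (Set.left_mem_Icc.mpr hT.le))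
  refine csSup_le ((Set.nonempty_Icc.mpr hT.le).image _) ?_
  rintro _ ⟨t, ht, rfl⟩
  have hsub : ∀ s ∈ Set.Icc 0 t, s ∈ Set.Icc 0 T := fun s hs => ⟨hs.1, hs.2.trans ht.2⟩
  rw [abs_sub_le_iff, sub_le_iff_le_add', sub_le_iff_le_add']
  exact ⟨Psi_sub_mul_runSSup_le_add ht.1 hγ.1 hC₀ (fun s hs => hX s (hsub s hs))
      (fun s hs => hK₂ s (hsub s hs))
      (fun s hs => hC s (hsub s hs)),
    Psi_sub_mul_runSSup_le_add ht.1 hγ.1 hC₀ (fun s hs => hX s (hsub s hs))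
      (fun s hs => hK₁ s (hsub s hs))
      (fun s hs => abs_sub_comm (K1 s) (K2 s) ▸ hC s (hsub s hs))⟩

end
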